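/- Let u : ℝ³ → ℝ be a smooth function of (x, y, t) satisfying the modified Veronese web equation u_ty = u_t u_xy − u_y u_tx at every point, and let X, Y, T : ℝ → ℝ be arbitrary smooth functions (of x, y, t respectively). Then each of the four functions φ(T) = T(t) u_t, υ(Y) = Y(y) u_y, θ₀(X) = X(x) u_x − X'(x) u, and θ₁(X) = X(x) satisfies the linearized modified Veronese web equation ℓ_E(φ) := φ_ty − u_t φ_xy + u_y φ_tx − u_xy φ_t + u_tx φ_y = 0 at every point of ℝ³. -/

import Mathlib

noncomputable section

/-- Partial derivative with respect to the first variable (`x`). -/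
def Dx (f : ℝ → ℝ → ℝ → ℝ) (x y t : ℝ) : ℝ := deriv (fun x' => f x' y t) x

/-- Partial derivative with respect to the second variable (`y`). -/
def Dy (f : ℝ → ℝ → ℝ → ℝ) (x y t : ℝ) : ℝ := deriv (fun y' => f x y' t) y

/-- Partial derivative with respect to the third variable (`t`). -/
def Dt (f : ℝ → ℝ → ℝ → ℝ) (x y t : ℝ) : ℝ := deriv (fun t' => f x y t') t

/-- Smoothness of a function of three real variables `(x, y, t)`. -/
def Smooth3 (f : ℝ → ℝ → ℝ → ℝ) : Prop :=
  ContDiff ℝ (⊤ : ℕ∞) (fun p : ℝ × ℝ × ℝ => f p.1 p.2.1 p.2.2)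

/-- Linearization of the modified Veronese web equation `u_ty = u_t u_xy - u_y u_tx`
at a solution `u`. -/
def linMVWE (u φ : ℝ → ℝ → ℝ → ℝ) (x y t : ℝ) : ℝ :=
  Dt (Dy φ) x y t - Dt u x y t * Dx (Dy φ) x y t + Dy u x y t * Dt (Dx φ) x y t
    - Dx (Dy u) x y t * Dt φ x y t + Dt (Dx u) x y t * Dy φ x y t

namespace Smooth3

variable {f : ℝ → ℝ → ℝ → ℝ}

theorem hasDerivAt_x (hf : Smooth3 f) (x y t : ℝ) :
    HasDerivAt (fun x' => f x' y t) (Dx f x y t) x := by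
  have h : ContDiff ℝ (⊤ : ℕ∞) (fun x' => f x' y t) :=
    ContDiff.comp (g := fun p : ℝ × ℝ × ℝ => f p.1 p.2.1 p.2.2) (f := fun x' => (x', y, t)) hf
      (by fun_prop)
  exact (h.differentiable (by simp) x).hasDerivAt

theorem hasDerivAt_y (hf : Smooth3 f) (x y t : ℝ) :
    HasDerivAt (fun y' => f x y' t) (Dy f x y t) y := by
  have h : ContDiff ℝ (⊤ : ℕ∞) (fun y' => f x y' t) :=
    ContDiff.comp (g := fun p : ℝ × ℝ × ℝ => f p.1 p.2.1 p.2.2) (f := fun y' => (x, y', t)) hf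
      (by fun_prop)
  exact (h.differentiable (by simp) y).hasDerivAt

theorem hasDerivAt_t (hf : Smooth3 f) (x y t : ℝ) :
    HasDerivAt (fun t' => f x y t') (Dt f x y t) t := by
  have h : ContDiff ℝ (⊤ : ℕ∞) (fun t' => f x y t') :=
    ContDiff.comp (g := fun p : ℝ × ℝ × ℝ => f p.1 p.2.1 p.2.2) (f := fun t' => (x, y, t')) hf
      (by fun_prop)
  exact (h.differentiable (by simp) t).hasDerivAt

theorem hasFDerivAt (hf : Smooth3 f) (p : ℝ × ℝ × ℝ) :
    HasFDerivAt (fun p : ℝ × ℝ × ℝ => f p.1 p.2.1 p.2.2)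
      (fderiv ℝ (fun p : ℝ × ℝ × ℝ => f p.1 p.2.1 p.2.2) p) p :=
  (ContDiff.differentiable hf (by simp) p).hasFDerivAt

theorem Dx_eq_fderiv (hf : Smooth3 f) (x y t : ℝ) :
    Dx f x y t = fderiv ℝ (fun p : ℝ × ℝ × ℝ => f p.1 p.2.1 p.2.2) (x, y, t) (1, 0, 0) :=
  (HasFDerivAt.comp_hasDerivAt (f := fun x' => (x', y, t)) x (hf.hasFDerivAt (x, y, t))
    ((hasDerivAt_id x).prodMk ((hasDerivAt_const x y).prodMk (hasDerivAt_const x t)))).deriv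

theorem Dy_eq_fderiv (hf : Smooth3 f) (x y t : ℝ) :
    Dy f x y t = fderiv ℝ (fun p : ℝ × ℝ × ℝ => f p.1 p.2.1 p.2.2) (x, y, t) (0, 1, 0) :=
  (HasFDerivAt.comp_hasDerivAt (f := fun y' => (x, y', t)) y (hf.hasFDerivAt (x, y, t))
    ((hasDerivAt_const y x).prodMk ((hasDerivAt_id y).prodMk (hasDerivAt_const y t)))).deriv

theorem Dt_eq_fderiv (hf : Smooth3 f) (x y t : ℝ) :
    Dt f x y t = fderiv ℝ (fun p : ℝ × ℝ × ℝ => f p.1 p.2.1 p.2.2) (x, y, t) (0, 0, 1) :=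
  (HasFDerivAt.comp_hasDerivAt (f := fun t' => (x, y, t')) t (hf.hasFDerivAt (x, y, t))
    ((hasDerivAt_const t x).prodMk ((hasDerivAt_const t y).prodMk (hasDerivAt_id t)))).deriv

theorem contDiff_fderiv_apply (hf : Smooth3 f) (v : ℝ × ℝ × ℝ) :
    ContDiff ℝ (⊤ : ℕ∞)
      (fun p => fderiv ℝ (fun p : ℝ × ℝ × ℝ => f p.1 p.2.1 p.2.2) p v) :=
  (ContDiff.fderiv_right hf (by simp)).clm_apply contDiff_const

theorem Dx (hf : Smooth3 f) : Smooth3 (Dx f) := by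
  simpa only [Smooth3, hf.Dx_eq_fderiv] using hf.contDiff_fderiv_apply (1, 0, 0)

theorem Dy (hf : Smooth3 f) : Smooth3 (Dy f) := by
  simpa only [Smooth3, hf.Dy_eq_fderiv] using hf.contDiff_fderiv_apply (0, 1, 0)

theorem Dt (hf : Smooth3 f) : Smooth3 (Dt f) := by
  simpa only [Smooth3, hf.Dt_eq_fderiv] using hf.contDiff_fderiv_apply (0, 0, 1)

theorem fderiv_fderiv_apply_comm (hf : Smooth3 f) (p v w : ℝ × ℝ × ℝ) :
    fderiv ℝ (fun q => fderiv ℝ (fun p : ℝ × ℝ × ℝ => f p.1 p.2.1 p.2.2) q v) p w =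
      fderiv ℝ (fun q => fderiv ℝ (fun p : ℝ × ℝ × ℝ => f p.1 p.2.1 p.2.2) q w) p v := by
  have hd : DifferentiableAt ℝ (fderiv ℝ (fun p : ℝ × ℝ × ℝ => f p.1 p.2.1 p.2.2)) p :=
    (ContDiff.fderiv_right (m := (⊤ : ℕ∞)) hf (by simp)).differentiable (by simp) p
  have hs : IsSymmSndFDerivAt ℝ (fun p : ℝ × ℝ × ℝ => f p.1 p.2.1 p.2.2) p :=
    (ContDiff.contDiffAt hf).isSymmSndFDerivAt
      (by simpa using WithTop.coe_le_coe.2 (le_top : (2 : ℕ∞) ≤ ⊤))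
  rw [fderiv_clm_apply hd (differentiableAt_const v), fderiv_clm_apply hd (differentiableAt_const w)]
  simpa using hs w v

theorem Dy_Dx (hf : Smooth3 f) : _root_.Dy (_root_.Dx f) = _root_.Dx (_root_.Dy f) := by
  funext x y t
  rw [hf.Dx.Dy_eq_fderiv, hf.Dy.Dx_eq_fderiv]
  simpa only [hf.Dx_eq_fderiv, hf.Dy_eq_fderiv] using hf.fderiv_fderiv_apply_comm (x, y, t) _ _

theorem Dx_Dt (hf : Smooth3 f) : _root_.Dx (_root_.Dt f) = _root_.Dt (_root_.Dx f) := by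
  funext x y t
  rw [hf.Dt.Dx_eq_fderiv, hf.Dx.Dt_eq_fderiv]
  simpa only [hf.Dx_eq_fderiv, hf.Dt_eq_fderiv] using hf.fderiv_fderiv_apply_comm (x, y, t) _ _

theorem Dy_Dt (hf : Smooth3 f) : _root_.Dy (_root_.Dt f) = _root_.Dt (_root_.Dy f) := by
  funext x y t
  rw [hf.Dt.Dy_eq_fderiv, hf.Dy.Dt_eq_fderiv]
  simpa only [hf.Dy_eq_fderiv, hf.Dt_eq_fderiv] using hf.fderiv_fderiv_apply_comm (x, y, t) _ _

end Smooth3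

/-- Local symmetries of the modified Veronese web equation. -/
theorem mvwe_local_symmetries
    (u : ℝ → ℝ → ℝ → ℝ) (hu : Smooth3 u)
    (husol : ∀ x y t : ℝ, Dt (Dy u) x y t = Dt u x y t * Dx (Dy u) x y t - Dy u x y t * Dt (Dx u) x y t)
    (X Y T : ℝ → ℝ) (hX : ContDiff ℝ (⊤ : ℕ∞) X) (hY : ContDiff ℝ (⊤ : ℕ∞) Y) (hT : ContDiff ℝ (⊤ : ℕ∞) T) :
    (∀ x y t : ℝ,
      linMVWE u (fun x y t => T t * Dt u x y t) x y t = 0) ∧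
    (∀ x y t : ℝ,
      linMVWE u (fun x y t => Y y * Dy u x y t) x y t = 0) ∧
    (∀ x y t : ℝ,
      linMVWE u (fun x y t => X x * Dx u x y t - deriv X x * u x y t) x y t = 0) ∧
    (∀ x y t : ℝ,
      linMVWE u (fun x y t => X x) x y t = 0) := by
  have hE : Dt (Dy u) = fun x y t => Dt u x y t * Dx (Dy u) x y t - Dy u x y t * Dt (Dx u) x y t := by
    funext x y t
    exact husol x y t
  have hX' : ContDiff ℝ (⊤ : ℕ∞) (deriv X) := (contDiff_infty_iff_deriv.mp hX).2
  have dX (x : ℝ) : HasDerivAt X (deriv X x) x := (hX.differentiable (by simp) x).hasDerivAt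
  have dX' (x : ℝ) : HasDerivAt (deriv X) (deriv (deriv X) x) x :=
    (hX'.differentiable (by simp) x).hasDerivAt
  have dY (y : ℝ) : HasDerivAt Y (deriv Y y) y := (hY.differentiable (by simp) y).hasDerivAt
  have dT (t : ℝ) : HasDerivAt T (deriv T t) t := (hT.differentiable (by simp) t).hasDerivAt
  -- the three differential consequences of the equation
  have ex (x y t : ℝ) : Dx (Dt (Dy u)) x y t =
      (Dx (Dt u) x y t * Dx (Dy u) x y t + Dt u x y t * Dx (Dx (Dy u)) x y t)
        - (Dx (Dy u) x y t * Dt (Dx u) x y t + Dy u x y t * Dx (Dt (Dx u)) x y t) := by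
    conv_lhs => rw [hE]
    exact (((hu.Dt.hasDerivAt_x x y t).mul (hu.Dy.Dx.hasDerivAt_x x y t)).sub
      ((hu.Dy.hasDerivAt_x x y t).mul (hu.Dx.Dt.hasDerivAt_x x y t))).deriv
  have ey (x y t : ℝ) : Dy (Dt (Dy u)) x y t =
      (Dy (Dt u) x y t * Dx (Dy u) x y t + Dt u x y t * Dy (Dx (Dy u)) x y t)
        - (Dy (Dy u) x y t * Dt (Dx u) x y t + Dy u x y t * Dy (Dt (Dx u)) x y t) := by
    conv_lhs => rw [hE]
    exact (((hu.Dt.hasDerivAt_y x y t).mul (hu.Dy.Dx.hasDerivAt_y x y t)).sub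
      ((hu.Dy.hasDerivAt_y x y t).mul (hu.Dx.Dt.hasDerivAt_y x y t))).deriv
  have et (x y t : ℝ) : Dt (Dt (Dy u)) x y t =
      (Dt (Dt u) x y t * Dx (Dy u) x y t + Dt u x y t * Dt (Dx (Dy u)) x y t)
        - (Dt (Dy u) x y t * Dt (Dx u) x y t + Dy u x y t * Dt (Dt (Dx u)) x y t) := by
    conv_lhs => rw [hE]
    exact (((hu.Dt.hasDerivAt_t x y t).mul (hu.Dy.Dx.hasDerivAt_t x y t)).sub
      ((hu.Dy.hasDerivAt_t x y t).mul (hu.Dx.Dt.hasDerivAt_t x y t))).deriv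
  refine ⟨fun x y t => ?_, fun x y t => ?_, fun x y t => ?_, fun x y t => ?_⟩
  · have hx : Dx (fun x y t => T t * Dt u x y t) = fun x y t => T t * Dt (Dx u) x y t := by
      funext x y t
      rw [← hu.Dx_Dt]
      exact ((hu.Dt.hasDerivAt_x x y t).const_mul (T t)).deriv
    have hy : Dy (fun x y t => T t * Dt u x y t) = fun x y t => T t * Dt (Dy u) x y t := by
      funext x y t
      rw [← hu.Dy_Dt]
      exact ((hu.Dt.hasDerivAt_y x y t).const_mul (T t)).deriv
    have ht : Dt (fun x y t => T t * Dt u x y t) x y t =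
        deriv T t * Dt u x y t + T t * Dt (Dt u) x y t :=
      ((dT t).mul (hu.Dt.hasDerivAt_t x y t)).deriv
    have hyt : Dt (fun x y t => T t * Dt (Dy u) x y t) x y t =
        deriv T t * Dt (Dy u) x y t + T t * Dt (Dt (Dy u)) x y t :=
      ((dT t).mul (hu.Dy.Dt.hasDerivAt_t x y t)).deriv
    have hxt : Dt (fun x y t => T t * Dt (Dx u) x y t) x y t =
        deriv T t * Dt (Dx u) x y t + T t * Dt (Dt (Dx u)) x y t :=
      ((dT t).mul (hu.Dx.Dt.hasDerivAt_t x y t)).deriv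
    have hxy : Dx (fun x y t => T t * Dt (Dy u) x y t) x y t = T t * Dt (Dx (Dy u)) x y t := by
      rw [← hu.Dy.Dx_Dt]
      exact ((hu.Dy.Dt.hasDerivAt_x x y t).const_mul (T t)).deriv
    simp only [linMVWE, hx, hy, ht, hyt, hxt, hxy]
    linear_combination T t * et x y t + deriv T t * husol x y t
  · have hx : Dx (fun x y t => Y y * Dy u x y t) = fun x y t => Y y * Dx (Dy u) x y t := by
      funext x y t
      exact ((hu.Dy.hasDerivAt_x x y t).const_mul (Y y)).deriv
    have hy : Dy (fun x y t => Y y * Dy u x y t) =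
        fun x y t => deriv Y y * Dy u x y t + Y y * Dy (Dy u) x y t := by
      funext x y t
      exact ((dY y).mul (hu.Dy.hasDerivAt_y x y t)).deriv
    have ht : Dt (fun x y t => Y y * Dy u x y t) x y t = Y y * Dt (Dy u) x y t :=
      ((hu.Dy.hasDerivAt_t x y t).const_mul (Y y)).deriv
    have hyt : Dt (fun x y t => deriv Y y * Dy u x y t + Y y * Dy (Dy u) x y t) x y t =
        deriv Y y * Dt (Dy u) x y t + Y y * Dy (Dt (Dy u)) x y t := by
      rw [hu.Dy.Dy_Dt]
      exact (((hu.Dy.hasDerivAt_t x y t).const_mul (deriv Y y)).add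
        ((hu.Dy.Dy.hasDerivAt_t x y t).const_mul (Y y))).deriv
    have hxt : Dt (fun x y t => Y y * Dx (Dy u) x y t) x y t = Y y * Dy (Dt (Dx u)) x y t := by
      rw [hu.Dx.Dy_Dt, hu.Dy_Dx]
      exact ((hu.Dy.Dx.hasDerivAt_t x y t).const_mul (Y y)).deriv
    have hxy : Dx (fun x y t => deriv Y y * Dy u x y t + Y y * Dy (Dy u) x y t) x y t =
        deriv Y y * Dx (Dy u) x y t + Y y * Dy (Dx (Dy u)) x y t := by
      rw [hu.Dy.Dy_Dx]
      exact (((hu.Dy.hasDerivAt_x x y t).const_mul (deriv Y y)).add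
        ((hu.Dy.Dy.hasDerivAt_x x y t).const_mul (Y y))).deriv
    have ey' := ey x y t
    rw [hu.Dy_Dt] at ey'
    simp only [linMVWE, hx, hy, ht, hyt, hxt, hxy]
    linear_combination Y y * ey' + deriv Y y * husol x y t
  · have hx : Dx (fun x y t => X x * Dx u x y t - deriv X x * u x y t) =
        fun x y t => X x * Dx (Dx u) x y t - deriv (deriv X) x * u x y t := by
      funext x y t
      refine (((dX x).mul (hu.Dx.hasDerivAt_x x y t)).sub
        ((dX' x).mul (hu.hasDerivAt_x x y t))).deriv.trans ?_
      ring
    have hy : Dy (fun x y t => X x * Dx u x y t - deriv X x * u x y t) =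
        fun x y t => X x * Dx (Dy u) x y t - deriv X x * Dy u x y t := by
      funext x y t
      rw [← hu.Dy_Dx]
      exact (((hu.Dx.hasDerivAt_y x y t).const_mul (X x)).sub
        ((hu.hasDerivAt_y x y t).const_mul (deriv X x))).deriv
    have ht : Dt (fun x y t => X x * Dx u x y t - deriv X x * u x y t) x y t =
        X x * Dt (Dx u) x y t - deriv X x * Dt u x y t :=
      (((hu.Dx.hasDerivAt_t x y t).const_mul (X x)).sub
        ((hu.hasDerivAt_t x y t).const_mul (deriv X x))).deriv
    have hyt : Dt (fun x y t => X x * Dx (Dy u) x y t - deriv X x * Dy u x y t) x y t =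
        X x * Dx (Dt (Dy u)) x y t - deriv X x * Dt (Dy u) x y t := by
      rw [hu.Dy.Dx_Dt]
      exact (((hu.Dy.Dx.hasDerivAt_t x y t).const_mul (X x)).sub
        ((hu.Dy.hasDerivAt_t x y t).const_mul (deriv X x))).deriv
    have hxt : Dt (fun x y t => X x * Dx (Dx u) x y t - deriv (deriv X) x * u x y t) x y t =
        X x * Dx (Dt (Dx u)) x y t - deriv (deriv X) x * Dt u x y t := by
      rw [hu.Dx.Dx_Dt]
      exact (((hu.Dx.Dx.hasDerivAt_t x y t).const_mul (X x)).sub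
        ((hu.hasDerivAt_t x y t).const_mul (deriv (deriv X) x))).deriv
    have hxy : Dx (fun x y t => X x * Dx (Dy u) x y t - deriv X x * Dy u x y t) x y t =
        X x * Dx (Dx (Dy u)) x y t - deriv (deriv X) x * Dy u x y t := by
      refine (((dX x).mul (hu.Dy.Dx.hasDerivAt_x x y t)).sub
        ((dX' x).mul (hu.Dy.hasDerivAt_x x y t))).deriv.trans ?_
      ring
    have ex' := ex x y t
    rw [hu.Dx_Dt] at ex'
    simp only [linMVWE, hx, hy, ht, hyt, hxt, hxy]
    linear_combination X x * ex' - deriv X x * husol x y t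
  · simp [linMVWE, Dx, Dy, Dt]
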